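/- There exists a self-dual binary linear code C ⊆ F₂^{72} whose minimum nonzero Hamming weight is 12, which contains exactly 882 codewords of Hamming weight 12 and exactly 7488 codewords of Hamming weight 14 (the weight enumerator W_{72,1} with γ = 18 and β = 441). -/

import Mathlib

/-- A subspace `C` of `(ZMod 2)^ι` is self-dual if it equals its Euclidean dual. -/
def IsSelfDual {R : Type*} [CommRing R] {ι : Type*} [Fintype ι]
    (C : Submodule R (ι → R)) : Prop :=
  ∀ x, x ∈ C ↔ ∀ y ∈ C, ∑ i, x i * y i = 0

/-- The Hamming weight of a vector: the number of nonzero coordinates. -/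
def hamWt {ι : Type*} [Fintype ι] {R : Type*} [Zero R] [DecidableEq R] (v : ι → R) : ℕ :=
  (Finset.univ.filter fun i => v i ≠ 0).card

/-- The natural number with the given binary digits, least significant first. -/
def ofBits : List Bool → ℕ
  | [] => 0
  | b :: l => Nat.bit b (ofBits l)

theorem testBit_ofBits (l : List Bool) (i : ℕ) : (ofBits l).testBit i = l.getD i false := by
  induction l generalizing i with
  | nil => simp [ofBits]
  | cons b l ih => cases i <;> simp [ofBits, Nat.testBit_bit_succ, ih]

theorem ofBits_append (l l' : List Bool) :
    ofBits (l ++ l') = ofBits l + ofBits l' <<< l.length := by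
  induction l with
  | nil => simp [ofBits]
  | cons b l ih =>
    simp only [List.cons_append, ofBits, ih, Nat.bit_val, Nat.shiftLeft_eq, List.length_cons,
      pow_succ]
    ring

theorem ofBits_map_not (l : List Bool) :
    ofBits (l.map not) = ofBits l ^^^ (2 ^ l.length - 1) := by
  refine Nat.eq_of_testBit_eq fun i => ?_
  rw [Nat.testBit_xor, testBit_ofBits, testBit_ofBits, Nat.testBit_two_pow_sub_one]
  by_cases h : i < l.length <;> simp [List.getD_eq_getElem?_getD, h]

/-- The number of ones among the `2 ^ d` lowest binary digits of `m`. -/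
def popCount : ℕ → ℕ → ℕ
  | 0, m => m % 2
  | d + 1, m => bif m == 0 then 0 else popCount d (m % 2 ^ 2 ^ d) + popCount d (m >>> 2 ^ d)

theorem popCount_eq_sum (d m : ℕ) :
    popCount d m = ∑ i ∈ Finset.range (2 ^ d), (m.testBit i).toNat := by
  induction d generalizing m with
  | zero => rcases Nat.mod_two_eq_zero_or_one m with h | h <;> simp [popCount, Nat.testBit_zero, h]
  | succ d ih =>
    rw [popCount]
    rcases eq_or_ne m 0 with rfl | hm
    · simp
    · rw [pow_succ, mul_two, Finset.sum_range_add]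
      simp only [beq_eq_false_iff_ne.2 hm, cond_false, ih]
      congr 1
      · refine Finset.sum_congr rfl fun i hi => ?_
        simp [Nat.testBit_mod_two_pow, Finset.mem_range.1 hi]
      · simp [Nat.testBit_shiftRight]

theorem sum_testBit_ofBits (l : List Bool) (n : ℕ) (h : l.length ≤ n) :
    ∑ i ∈ Finset.range n, ((ofBits l).testBit i).toNat = l.count true := by
  induction l generalizing n with
  | nil => simp [ofBits]
  | cons b l ih =>
    obtain ⟨n, rfl⟩ : ∃ k, n = k + 1 := ⟨n - 1, by simp at h; omega⟩
    rw [Finset.sum_range_succ']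
    simp only [ofBits, Nat.testBit_bit_succ, Nat.testBit_bit_zero]
    rw [ih n (by simpa using h)]
    cases b <;> simp

theorem popCount_ofBits (l : List Bool) (d : ℕ) (h : l.length ≤ 2 ^ d) :
    popCount d (ofBits l) = l.count true := by
  rw [popCount_eq_sum, sum_testBit_ofBits l _ h]

/-- Adds a carry to bit-sliced counters: digit `i` of the `k`-th entry is the `k`-th binary
digit of the `i`-th counter. -/
def addBit : List ℕ → ℕ → List ℕ
  | [], c => [c]
  | b :: bs, c => (b ^^^ c) :: addBit bs (b &&& c)

/-- Adds two families of bit-sliced counters and a carry. -/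
def addCarry : List ℕ → List ℕ → ℕ → List ℕ
  | [], bs, c => addBit bs c
  | a :: as, [], c => (a ^^^ c) :: addBit as (a &&& c)
  | a :: as, b :: bs, c =>
      (a ^^^ b ^^^ c) :: addCarry as bs ((a &&& b) ||| ((a ^^^ b) &&& c))

/-- The value of the `i`-th bit-sliced counter. -/
def counter : List ℕ → ℕ → ℕ
  | [], _ => 0
  | c :: cs, i => (c.testBit i).toNat + 2 * counter cs i

theorem counter_addBit (bs : List ℕ) (c i : ℕ) :
    counter (addBit bs c) i = counter bs i + (c.testBit i).toNat := by
  induction bs generalizing c with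
  | nil => simp [addBit, counter]
  | cons b bs ih =>
    simp only [addBit, counter, ih, Nat.testBit_xor, Nat.testBit_and]
    cases b.testBit i <;> cases c.testBit i <;> simp <;> omega

theorem counter_addCarry (as bs : List ℕ) (c i : ℕ) :
    counter (addCarry as bs c) i = counter as i + counter bs i + (c.testBit i).toNat := by
  induction as generalizing bs c with
  | nil => simp [addCarry, counter, counter_addBit]
  | cons a as ih =>
    cases bs with
    | nil =>
      simp only [addCarry, counter, counter_addBit, Nat.testBit_xor, Nat.testBit_and]
      cases a.testBit i <;> cases c.testBit i <;> simp <;> omega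
    | cons b bs =>
      simp only [addCarry, counter, ih, Nat.testBit_xor, Nat.testBit_and, Nat.testBit_or]
      cases a.testBit i <;> cases b.testBit i <;> cases c.testBit i <;> simp <;> omega

/-- One layer of a tree of adders. -/
def pairUp : List (List ℕ) → List (List ℕ)
  | a :: b :: l => addCarry a b 0 :: pairUp l
  | l => l

theorem sum_counter_pairUp (l : List (List ℕ)) (i : ℕ) :
    ((pairUp l).map (counter · i)).sum = (l.map (counter · i)).sum := by
  induction l using pairUp.induct with
  | case1 a b l ih => simp [pairUp, counter_addCarry, ih, add_assoc]
  | case2 l h => rw [pairUp]; exact h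

/-- Bit-sliced counters of the number of ones in each position of `ps`, using `d` layers of
a tree of adders. -/
def sumPlanes (d : ℕ) (ps : List ℕ) : List ℕ :=
  (pairUp^[d] (ps.map fun p => [p])).foldr (fun a b => addCarry a b 0) []

theorem counter_sumPlanes (d : ℕ) (ps : List ℕ) (i : ℕ) :
    counter (sumPlanes d ps) i = (ps.map fun p => (p.testBit i).toNat).sum := by
  have hfold (l : List (List ℕ)) :
      counter (l.foldr (fun a b => addCarry a b 0) []) i = (l.map (counter · i)).sum := by
    induction l with
    | nil => simp [counter]
    | cons a l ih => simp [counter_addCarry, ih]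
  have hiter (l : List (List ℕ)) :
      ((pairUp^[d] l).map (counter · i)).sum = (l.map (counter · i)).sum := by
    induction d generalizing l with
    | zero => rfl
    | succ d ih => rw [Function.iterate_succ_apply, ih, sum_counter_pairUp]
  rw [sumPlanes, hfold, hiter]
  simp [Function.comp_def, counter]

/-- Digit `i` is one if digit `i` of `full` is one and the `i`-th counter equals `w`. -/
def eqMask (full : ℕ) : List ℕ → ℕ → ℕ
  | [], w => bif w == 0 then full else 0
  | c :: cs, w => (bif w % 2 == 1 then c else c ^^^ full) &&& eqMask full cs (w / 2)

theorem testBit_eqMask (full : ℕ) (cs : List ℕ) (w i : ℕ) :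
    (eqMask full cs w).testBit i = (full.testBit i && counter cs i == w) := by
  induction cs generalizing w with
  | nil => cases w <;> simp [eqMask, counter]
  | cons c cs ih =>
    simp only [eqMask, counter, Nat.testBit_and, ih]
    rcases Nat.mod_two_eq_zero_or_one w with h | h <;>
    cases hf : full.testBit i <;> cases hc : c.testBit i <;>
    simp [h, hf, hc] <;> grind

/-- A list of binary vectors in bit-sliced form: its length and, for each coordinate, the number
whose binary digits are the entries of the vectors at this coordinate. -/
def pack {m : ℕ} (ws : List (Fin m → ZMod 2)) : ℕ × List ℕ :=
  (ws.length, (List.finRange m).map fun j => ofBits (ws.map fun v => decide (v j ≠ 0)))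

/-- Concatenation of lists of vectors in bit-sliced form. -/
def packedAppend (x y : ℕ × List ℕ) : ℕ × List ℕ :=
  (x.1 + y.1, List.zipWith (fun p q => p + q <<< x.1) x.2 y.2)

/-- Adds the vector `r` to all vectors of a list in bit-sliced form. -/
def packedAdd (r : List Bool) (x : ℕ × List ℕ) : ℕ × List ℕ :=
  (x.1, List.zipWith (fun b p => bif b then p ^^^ (2 ^ x.1 - 1) else p) r x.2)

/-- The number of vectors of weight `w` in a list in bit-sliced form. -/
def packedCount (d w : ℕ) (x : ℕ × List ℕ) : ℕ :=
  popCount (x.1.log2 + 1) (eqMask (2 ^ x.1 - 1) (sumPlanes d x.2) w)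

theorem pack_append {m : ℕ} (ws ws' : List (Fin m → ZMod 2)) :
    pack (ws ++ ws') = packedAppend (pack ws) (pack ws') := by
  simp [pack, packedAppend, ofBits_append, List.zipWith_map_left, List.zipWith_map_right]

theorem pack_map_add {m : ℕ} (r : Fin m → ZMod 2) (ws : List (Fin m → ZMod 2)) :
    pack (ws.map (r + ·)) =
      packedAdd ((List.finRange m).map fun j => decide (r j ≠ 0)) (pack ws) := by
  have key : ∀ a b : ZMod 2, decide (a + b ≠ 0) = xor (decide (a ≠ 0)) (decide (b ≠ 0)) := by
    decide
  simp only [pack, packedAdd, List.length_map, List.zipWith_map_left, List.zipWith_map_right,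
    List.zipWith_self, List.map_map, Prod.mk.injEq, true_and]
  refine List.map_congr_left fun j _ => ?_
  simp only [Function.comp_def, Pi.add_apply, key]
  cases decide (r j ≠ 0)
  · simp
  · simpa [Function.comp_def] using ofBits_map_not (ws.map fun v => decide (v j ≠ 0))

theorem packedCount_pack {m : ℕ} (d w : ℕ) (ws : List (Fin m → ZMod 2)) :
    packedCount d w (pack ws) = ws.countP fun v => hamWt v == w := by
  have hmask : eqMask (2 ^ (pack ws).1 - 1) (sumPlanes d (pack ws).2) w =
      ofBits (ws.map fun v => hamWt v == w) := by
    refine Nat.eq_of_testBit_eq fun i => ?_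
    rw [testBit_eqMask, counter_sumPlanes, testBit_ofBits, Nat.testBit_two_pow_sub_one]
    by_cases h : i < ws.length
    · simp only [pack, h, decide_true, Bool.true_and, List.map_map, Function.comp_def,
        testBit_ofBits, List.getD_eq_getElem?_getD, List.getElem?_map, List.getElem?_eq_getElem h,
        Option.map_some, Option.getD_some]
      congr 1
      rw [← List.ofFn_eq_map, List.sum_ofFn, hamWt, Finset.card_filter]
      refine Finset.sum_congr rfl fun j _ => ?_
      by_cases hj : ws[i] j = 0 <;> simp [hj]
    · simp [pack, h, List.getD_eq_getElem?_getD]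
  rw [packedCount, hmask, popCount_ofBits]
  · simp [List.count, List.countP_map, Function.comp_def]
  · simpa [pack] using Nat.lt_log2_self.le

/-- All sums of `k` of the vectors `rs`. -/
def combinations {V : Type*} [AddCommMonoid V] (rs : List V) (k : ℕ) : List V :=
  (rs.sublistsLen k).map List.sum

theorem combinations_zero {V : Type*} [AddCommMonoid V] (rs : List V) :
    combinations rs 0 = [0] := by
  simp [combinations]

theorem combinations_cons_succ {V : Type*} [AddCommMonoid V] (r : V) (rs : List V) (k : ℕ) :
    combinations (r :: rs) (k + 1) =
      combinations rs (k + 1) ++ (combinations rs k).map (r + ·) := by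
  simp [combinations, List.sublistsLen_succ_cons, Function.comp_def]

/-- Updates the packed lists of the sums of `k`, `k + 1`, … rows when the row `r` is added;
the first argument after `r` is the packed list for `k` rows, the second one holds those for
`k + 1`, `k + 2`, … rows. -/
def addRow (r : List Bool) : ℕ × List ℕ → List (ℕ × List ℕ) → List (ℕ × List ℕ)
  | _, [] => []
  | x, y :: l => packedAppend y (packedAdd r x) :: addRow r y l

/-- The packed lists of the sums of `0`, …, `K` of the given rows of length `m`. -/
def packedSums (m K : ℕ) : List (List Bool) → List (ℕ × List ℕ)
  | [] => (1, List.replicate m 0) :: List.replicate K (0, List.replicate m 0)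
  | r :: rs => match packedSums m K rs with
    | [] => []
    | x :: l => x :: addRow r x l

theorem addRow_pack {m : ℕ} (r : Fin m → ZMod 2) (rs : List (Fin m → ZMod 2)) (k n : ℕ) :
    addRow ((List.finRange m).map fun j => decide (r j ≠ 0)) (pack (combinations rs k))
        ((List.range' (k + 1) n).map fun k => pack (combinations rs k)) =
      (List.range' (k + 1) n).map fun k => pack (combinations (r :: rs) k) := by
  induction n generalizing k with
  | zero => rfl
  | succ n ih =>
    simp only [List.range'_succ, List.map_cons, addRow, ih, combinations_cons_succ, pack_append,
      pack_map_add]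

theorem packedSums_eq {m : ℕ} (K : ℕ) (rs : List (Fin m → ZMod 2)) :
    packedSums m K (rs.map fun r => (List.finRange m).map fun j => decide (r j ≠ 0)) =
      (List.range' 0 (K + 1)).map fun k => pack (combinations rs k) := by
  induction rs with
  | nil =>
    simp only [List.map_nil, packedSums, List.range'_succ, List.map_cons, combinations_zero]
    congr 1
    · simp [pack, ofBits]
    · refine (List.eq_replicate_iff.2 ⟨by simp, ?_⟩).symm
      simp only [List.mem_map, List.mem_range'_1]
      rintro _ ⟨k, ⟨hk, -⟩, rfl⟩
      obtain ⟨k, rfl⟩ : ∃ i, k = i + 1 := ⟨k - 1, by omega⟩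
      simp [combinations, pack, ofBits]
  | cons r rs ih =>
    simp only [List.map_cons, packedSums, ih]
    simp only [List.range'_succ, List.map_cons, zero_add, addRow_pack r rs 0]
    simp only [combinations_zero]

theorem countP_combinations {n m : ℕ} (M : Fin n → Fin m → ZMod 2) (k : ℕ)
    (p : (Fin m → ZMod 2) → Bool) :
    (combinations ((List.finRange n).map M) k).countP p =
      Fintype.card {u : Fin n → ZMod 2 // hamWt u = k ∧ p (∑ i, u i • M i)} := by
  have h₁ : (combinations ((List.finRange n).map M) k).countP p =
      ((Finset.univ.powersetCard k).filter fun s : Finset (Fin n) => p (∑ i ∈ s, M i)).card := by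
    have h := Finset.map_val_val_powersetCard (Finset.univ : Finset (Fin n)) k
    rw [Finset.card_def, Finset.filter_val, ← Multiset.countP_eq_card_filter]
    have h₂ : (Finset.univ : Finset (Fin n)).val = (List.finRange n : Multiset (Fin n)) := rfl
    have h₃ : (combinations ((List.finRange n).map M) k : Multiset (Fin m → ZMod 2)) =
        ((List.finRange n : Multiset (Fin n)).powersetCard k).map fun s => (s.map M).sum := by
      trans (((List.finRange n).map M : Multiset (Fin m → ZMod 2)).powersetCard k).map Multiset.sum
      · rw [Multiset.powersetCard_coe]
        simp [combinations, Function.comp_def]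
      · rw [← Multiset.map_coe, Multiset.powersetCard_map, Multiset.map_map]
        rfl
    have h₄ : (combinations ((List.finRange n).map M) k).countP p = Multiset.countP (p · = true)
        (combinations ((List.finRange n).map M) k : Multiset (Fin m → ZMod 2)) := by simp
    rw [h₄, h₃, ← h₂, ← h, Multiset.map_map, Multiset.countP_map, ← Multiset.countP_eq_card_filter]
    rfl
  rw [h₁, Fintype.card_subtype]
  have hbin : ∀ a : ZMod 2, a ≠ 0 → a = 1 := by decide
  refine Finset.card_bij' (fun s _ i => if i ∈ s then 1 else 0)
    (fun u _ => Finset.univ.filter fun i => u i ≠ 0) ?_ ?_ ?_ ?_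
  · intro s hs
    simp only [Finset.mem_filter, Finset.mem_powersetCard, Finset.subset_univ, true_and] at hs
    simp only [Finset.mem_filter, Finset.mem_univ, true_and]
    refine ⟨by simp [hamWt, hs.1], ?_⟩
    rw [show ∑ i, (if i ∈ s then (1 : ZMod 2) else 0) • M i = ∑ i ∈ s, M i by simp [ite_smul]]
    exact hs.2
  · intro u hu
    simp only [Finset.mem_filter, Finset.mem_univ, true_and] at hu
    simp only [Finset.mem_filter, Finset.mem_powersetCard, Finset.subset_univ, true_and]
    refine ⟨hu.1, ?_⟩
    rw [Finset.sum_filter]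
    convert hu.2 using 4 with i
    by_cases h : u i = 0
    · simp [h]
    · simp [hbin _ h]
  · intro s _
    ext i
    simp
  · intro u _
    ext i
    by_cases h : u i = 0
    · simp [h]
    · simp [hbin _ h]

/-- Given the packed lists of the sums of `0`, `1`, … rows of `M`, counts the `u` of weight at
most `K` for which the weights of `u` and `u M` add up to `t`. -/
def countTotal (d K t : ℕ) (l : List (ℕ × List ℕ)) : ℕ :=
  ∑ k ∈ Finset.range (K + 1), if k ≤ t then packedCount d (t - k) (l.getD k (0, [])) else 0

theorem countTotal_packedSums {n m : ℕ} (M : Fin n → Fin m → ZMod 2) (d K t L : ℕ)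
    (hK : K ≤ L) :
    countTotal d K t (packedSums m L
        ((List.finRange n).map fun i => (List.finRange m).map fun j => decide (M i j ≠ 0))) =
      (Finset.univ.filter fun u : Fin n → ZMod 2 =>
        hamWt u ≤ K ∧ hamWt u + hamWt (∑ i, u i • M i) = t).card := by
  have h := packedSums_eq L ((List.finRange n).map M)
  rw [List.map_map] at h
  simp only [Function.comp_def] at h
  rw [countTotal, h, Finset.card_eq_sum_card_fiberwise (f := hamWt) (t := Finset.range (K + 1))]
  · refine Finset.sum_congr rfl fun k hk => ?_
    rw [Finset.mem_range] at hk
    have hk' : ((List.range' 0 (L + 1)).map fun k =>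
        pack (combinations ((List.finRange n).map M) k)).getD k (0, []) =
        pack (combinations ((List.finRange n).map M) k) := by
      rw [List.getD_eq_getElem _ _ (by simp; omega)]
      simp
    rw [hk', packedCount_pack, countP_combinations, Fintype.card_subtype, Finset.filter_filter]
    rcases le_or_gt k t with hkt | hkt
    · rw [if_pos hkt]
      congr 1
      refine Finset.filter_congr fun u _ => ?_
      simp only [beq_iff_eq]
      omega
    · rw [if_neg hkt.not_ge, eq_comm, Finset.card_eq_zero, Finset.filter_eq_empty_iff]
      intro u _
      omega
  · intro u hu
    simp only [Finset.coe_filter, Finset.mem_univ, true_and, Set.mem_ofPred_eq] at hu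
    simpa using Nat.lt_succ_of_le hu.1

open Matrix in
/-- The binary code of length `n + n` with generator matrix `(I | M)`. -/
def doubleCode {n : ℕ} (M : Matrix (Fin n) (Fin n) (ZMod 2)) :
    Submodule (ZMod 2) (Fin (n + n) → ZMod 2) where
  carrier := {v | (fun j => v (Fin.natAdd n j)) = (fun i => v (Fin.castAdd n i)) ᵥ* M}
  add_mem' {v w} hv hw := by
    simp only [Set.mem_ofPred_eq] at hv hw ⊢
    exact (congrArg₂ (· + ·) hv hw).trans (Matrix.add_vecMul _ _ _).symm
  zero_mem' := (Matrix.zero_vecMul M).symm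
  smul_mem' c v hv := by
    simp only [Set.mem_ofPred_eq] at hv ⊢
    exact (congrArg (c • ·) hv).trans (Matrix.smul_vecMul _ _ _).symm

section doubleCode

open Matrix

variable {n : ℕ} {M : Matrix (Fin n) (Fin n) (ZMod 2)}

theorem append_mem_doubleCode (u w : Fin n → ZMod 2) :
    Fin.append u w ∈ doubleCode M ↔ w = u ᵥ* M := by
  change (fun j => Fin.append u w (Fin.natAdd n j)) =
    (fun i => Fin.append u w (Fin.castAdd n i)) ᵥ* M ↔ _
  simp only [Fin.append_left, Fin.append_right]

theorem exists_append (v : Fin (n + n) → ZMod 2) : ∃ u w : Fin n → ZMod 2, v = Fin.append u w :=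
  ⟨_, _, (Fin.append_castAdd_natAdd (f := v)).symm⟩

theorem sum_append_mul_append (u w u' w' : Fin n → ZMod 2) :
    ∑ i, Fin.append u w i * Fin.append u' w' i = u ⬝ᵥ u' + w ⬝ᵥ w' := by
  simp only [Fin.sum_univ_add, Fin.append_left, Fin.append_right, dotProduct]

theorem hamWt_append (u w : Fin n → ZMod 2) :
    hamWt (Fin.append u w) = hamWt u + hamWt w := by
  simp only [hamWt, Finset.card_filter, Fin.sum_univ_add, Fin.append_left, Fin.append_right]

theorem isSelfDual_doubleCode (hM : M * Mᵀ = 1) : IsSelfDual (doubleCode M) := by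
  intro x
  obtain ⟨u, w, rfl⟩ := exists_append x
  constructor
  · intro hx y hy
    obtain ⟨u', w', rfl⟩ := exists_append y
    rw [append_mem_doubleCode] at hx hy
    rw [sum_append_mul_append, hx, hy, ← Matrix.mulVec_transpose M u', Matrix.dotProduct_mulVec,
      Matrix.vecMul_vecMul, hM, Matrix.vecMul_one, CharTwo.add_self_eq_zero]
  · intro h
    have h' : ∀ u', u' ⬝ᵥ (u + M *ᵥ w) = 0 := fun u' => by
      have := h (Fin.append u' (u' ᵥ* M)) ((append_mem_doubleCode _ _).2 rfl)
      rwa [sum_append_mul_append, dotProduct_comm u, dotProduct_comm w, ← Matrix.dotProduct_mulVec,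
        ← dotProduct_add] at this
    have hu : u = M *ᵥ w := funext fun i =>
      CharTwo.add_eq_zero.1
        (congrFun (dotProduct_eq_zero (u + M *ᵥ w) fun u' => by rw [dotProduct_comm, h']) i)
    rw [append_mem_doubleCode, hu, ← Matrix.vecMul_transpose, Matrix.vecMul_vecMul,
      mul_eq_one_comm.1 hM, Matrix.vecMul_one]

theorem even_hamWt_of_mem (hM : M * Mᵀ = 1) {v : Fin (n + n) → ZMod 2} (hv : v ∈ doubleCode M) :
    Even (hamWt v) := by
  have h := (isSelfDual_doubleCode hM v).1 hv v hv
  have hsq : ∀ a : ZMod 2, a * a = if a ≠ 0 then 1 else 0 := by decide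
  simp only [hsq, Finset.sum_boole] at h
  exact (ZMod.natCast_eq_zero_iff_even).1 h

/-- A codeword of weight `t > 0` has weight at most `t / 2` in the left half or at most
`(t - 1) / 2` in the right half, but not both. -/
theorem card_doubleCode_hamWt (hM : M * Mᵀ = 1) {t : ℕ} (ht : t ≠ 0) :
    Nat.card {v : Fin (n + n) → ZMod 2 // v ∈ doubleCode M ∧ hamWt v = t} =
      (Finset.univ.filter fun u : Fin n → ZMod 2 =>
        hamWt u ≤ t / 2 ∧ hamWt u + hamWt (u ᵥ* M) = t).card +
      (Finset.univ.filter fun u : Fin n → ZMod 2 =>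
        hamWt u ≤ (t - 1) / 2 ∧ hamWt u + hamWt (u ᵥ* Mᵀ) = t).card := by
  have hM' := mul_eq_one_comm.1 hM
  have h₁ : Nat.card {v : Fin (n + n) → ZMod 2 // v ∈ doubleCode M ∧ hamWt v = t} =
      (Finset.univ.filter fun u : Fin n → ZMod 2 => hamWt u + hamWt (u ᵥ* M) = t).card := by
    classical
    rw [Nat.card_eq_fintype_card, Fintype.card_subtype]
    refine (Finset.card_bij (fun u _ => Fin.append u (u ᵥ* M)) ?_ ?_ ?_).symm
    · intro u hu
      simpa [append_mem_doubleCode, hamWt_append] using hu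
    · intro u _ u' _ h
      exact funext fun i => by simpa using congrFun h (Fin.castAdd n i)
    · intro v hv
      obtain ⟨u, w, rfl⟩ := exists_append v
      simp only [Finset.mem_filter, Finset.mem_univ, true_and, append_mem_doubleCode,
        hamWt_append] at hv
      obtain ⟨rfl, hv⟩ := hv
      exact ⟨u, by simpa using hv, rfl⟩
  have h₂ : (Finset.univ.filter fun u : Fin n → ZMod 2 =>
        hamWt u ≤ (t - 1) / 2 ∧ hamWt u + hamWt (u ᵥ* Mᵀ) = t).card =
      (Finset.univ.filter fun u : Fin n → ZMod 2 =>
        hamWt (u ᵥ* M) ≤ (t - 1) / 2 ∧ hamWt u + hamWt (u ᵥ* M) = t).card :=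
    Finset.card_bij' (fun w _ => w ᵥ* Mᵀ) (fun u _ => u ᵥ* M)
      (fun w hw => by simpa [hM', add_comm] using hw) (fun u hu => by simpa [hM, add_comm] using hu)
      (fun w _ => by simp [hM']) (fun u _ => by simp [hM])
  rw [h₁, h₂, ← Finset.card_union_of_disjoint]
  · congr 1
    ext u
    simp only [Finset.mem_filter, Finset.mem_union, Finset.mem_univ, true_and]
    omega
  · rw [Finset.disjoint_filter]
    intro u _ h h'
    omega

end doubleCode

/-- The binary matrix with the given Boolean entries. -/
def boolMatrix {n : ℕ} (B : Fin n → Fin n → Bool) : Matrix (Fin n) (Fin n) (ZMod 2) :=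
  fun i j => bif B i j then 1 else 0

theorem boolMatrix_mul_transpose {n : ℕ} {B : Fin n → Fin n → Bool}
    (hB : ∀ i j, (List.finRange n).foldr (fun k s => xor (B i k && B j k) s) false =
      decide (i = j)) :
    boolMatrix B * (boolMatrix B).transpose = 1 := by
  ext i j
  have hfold (l : List (Fin n)) :
      (l.map fun k => boolMatrix B i k * boolMatrix B j k).sum =
        bif l.foldr (fun k s => xor (B i k && B j k) s) false then 1 else 0 := by
    induction l with
    | nil => rfl
    | cons k l ih =>
      rw [List.map_cons, List.sum_cons, ih, List.foldr_cons, boolMatrix, boolMatrix]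
      generalize l.foldr (fun k s => xor (B i k && B j k) s) false = s
      cases B i k <;> cases B j k <;> cases s <;> rfl
  rw [Matrix.mul_apply, Matrix.one_apply]
  simp only [Matrix.transpose_apply]
  rw [← List.sum_ofFn, List.ofFn_eq_map, hfold, hB]
  by_cases h : i = j <;> simp [h]

theorem card_hamWt_boolMatrix {n : ℕ} (B : Fin n → Fin n → Bool) (d K t L : ℕ) (hK : K ≤ L) :
    (Finset.univ.filter fun u : Fin n → ZMod 2 =>
      hamWt u ≤ K ∧ hamWt u + hamWt (Matrix.vecMul u (boolMatrix B)) = t).card =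
    countTotal d K t
      (packedSums n L ((List.finRange n).map fun i => (List.finRange n).map (B i))) := by
  have hbit (i j : Fin n) : decide (boolMatrix B i j ≠ 0) = B i j := by
    rw [boolMatrix]
    cases B i j <;> rfl
  have h := countTotal_packedSums (boolMatrix B) d K t L hK
  simp only [hbit] at h
  rw [h]
  simp only [Matrix.vecMul_eq_sum]

theorem card_doubleCode_boolMatrix {n : ℕ} {B : Fin n → Fin n → Bool}
    (hB : boolMatrix B * (boolMatrix B).transpose = 1) (d : ℕ) {t L L' : ℕ} (ht : t ≠ 0)
    (hL : t / 2 ≤ L) (hL' : (t - 1) / 2 ≤ L') :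
    Nat.card {v : Fin (n + n) → ZMod 2 // v ∈ doubleCode (boolMatrix B) ∧ hamWt v = t} =
      countTotal d (t / 2) t
        (packedSums n L ((List.finRange n).map fun i => (List.finRange n).map fun j => B i j)) +
      countTotal d ((t - 1) / 2) t
        (packedSums n L'
          ((List.finRange n).map fun i => (List.finRange n).map fun j => B j i)) := by
  rw [card_doubleCode_hamWt hB ht, card_hamWt_boolMatrix B d _ t L hL,
    ← card_hamWt_boolMatrix (fun i j => B j i) d _ t L' hL']
  rfl

/-- The entries of the four-circulant matrix with rows `(A | B)` and `(Bᵀ | Aᵀ)` for the circulant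
matrices `A` and `B` of order 18 whose first rows are the binary digits of `2591` and `21885`. -/
def fourCirculant (i j : Fin 36) : Bool :=
  if i.1 < 18 then
    if j.1 < 18 then Nat.testBit 2591 ((j.1 + 18 - i.1) % 18)
    else Nat.testBit 21885 ((j.1 - i.1) % 18)
  else
    if j.1 < 18 then Nat.testBit 21885 ((i.1 - j.1) % 18)
    else Nat.testBit 2591 ((i.1 + 18 - j.1) % 18)

theorem fourCirculant_mul_transpose :
    boolMatrix fourCirculant * (boolMatrix fourCirculant).transpose = 1 :=
  boolMatrix_mul_transpose (by decide +kernel)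

theorem countTotal_fourCirculant :
    [2, 4, 6, 8, 10, 12, 14].map (fun t => countTotal 6 (t / 2) t (packedSums 36 7
      ((List.finRange 36).map fun i => (List.finRange 36).map fun j => fourCirculant i j))) =
    [0, 0, 0, 0, 0, 540, 5256] := by
  decide +kernel

theorem countTotal_fourCirculant_transpose :
    [2, 4, 6, 8, 10, 12, 14].map (fun t => countTotal 6 ((t - 1) / 2) t (packedSums 36 6
      ((List.finRange 36).map fun i => (List.finRange 36).map fun j => fourCirculant j i))) =
    [0, 0, 0, 0, 0, 342, 2232] := by
  decide +kernel

theorem card_fourCirculant {t : ℕ} (ht : t ∈ [2, 4, 6, 8, 10, 12, 14]) :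
    Nat.card {v : Fin 72 → ZMod 2 // v ∈ doubleCode (boolMatrix fourCirculant) ∧ hamWt v = t} =
      if t = 12 then 882 else if t = 14 then 7488 else 0 := by
  have h₁ := countTotal_fourCirculant
  have h₂ := countTotal_fourCirculant_transpose
  have hbound : t ≠ 0 ∧ t / 2 ≤ 7 ∧ (t - 1) / 2 ≤ 6 := by
    simp only [List.mem_cons, List.not_mem_nil, or_false] at ht
    omega
  refine (card_doubleCode_boolMatrix fourCirculant_mul_transpose 6 hbound.1 hbound.2.1
    hbound.2.2).trans ?_
  generalize packedSums 36 7 _ = x at h₁ ⊢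
  generalize packedSums 36 6 _ = y at h₂ ⊢
  simp only [List.map_cons, List.map_nil, List.cons.injEq, and_true] at h₁ h₂
  simp only [List.mem_cons, List.not_mem_nil, or_false] at ht
  rcases ht with rfl | rfl | rfl | rfl | rfl | rfl | rfl <;> simp [h₁, h₂]

/-- There is a self-dual binary linear code of length 72 with minimum nonzero Hamming
weight 12, having exactly 882 codewords of weight 12 and exactly 7488 codewords of
weight 14 (weight enumerator `W_{72,1}` with γ = 18 and β = 441). -/
theorem exists_selfDual_code_72_gamma_18_beta_441 :
    ∃ C : Submodule (ZMod 2) (Fin 72 → ZMod 2),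
      IsSelfDual C ∧
      IsLeast {k | ∃ v ∈ C, v ≠ 0 ∧ hamWt v = k} 12 ∧
      Nat.card {v : Fin 72 → ZMod 2 // v ∈ C ∧ hamWt v = 12} = 882 ∧
      Nat.card {v : Fin 72 → ZMod 2 // v ∈ C ∧ hamWt v = 14} = 7488 := by
  have hcard {t : ℕ} (ht : t ∈ [2, 4, 6, 8, 10, 12, 14]) := card_fourCirculant ht
  refine ⟨doubleCode (boolMatrix fourCirculant), isSelfDual_doubleCode fourCirculant_mul_transpose,
    ⟨?_, ?_⟩, hcard (by simp), hcard (by simp)⟩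
  · have h : Nat.card {v : Fin 72 → ZMod 2 //
        v ∈ doubleCode (boolMatrix fourCirculant) ∧ hamWt v = 12} ≠ 0 := by
      rw [hcard (by simp)]
      simp
    obtain ⟨⟨v, hv, hw⟩⟩ := (Nat.card_ne_zero.1 h).1
    refine ⟨v, hv, ?_, hw⟩
    rintro rfl
    simp [hamWt] at hw
  · rintro k ⟨v, hv, hv0, rfl⟩
    by_contra! hlt
    have heven := even_hamWt_of_mem fourCirculant_mul_transpose hv
    have hpos : hamWt v ≠ 0 := fun h => hv0 <| funext fun i => by
      simpa using Finset.filter_eq_empty_iff.1 (Finset.card_eq_zero.1 h) (Finset.mem_univ i)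
    have hmem : hamWt v ∈ [2, 4, 6, 8, 10, 12, 14] := by
      simp only [List.mem_cons, List.not_mem_nil, or_false]
      grind
    have h := hcard hmem
    rw [if_neg (by omega), if_neg (by omega), Nat.card_eq_zero] at h
    rcases h with h | h
    · exact h.false ⟨v, hv, rfl⟩
    · exact not_finite_iff_infinite.2 h inferInstance
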